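/- Let d ≥ 1 and let U = {u_1, …, u_k} be a finite set of non-zero vectors in ℤ^d that generate ℤ^d as a group. For every ε > 0 there exists n_0 = n_0(ε) such that: if S ⊆ ℤ^d is finite with |S| ≥ n_0 and ∂(S) ≤ (1+ε)∂*(|S|), then for each i ∈ [k] the set S_i = S + {0, u_i} satisfies ∂(S_i) ≤ (1+3ε)∂*(|S_i|). -/

import Mathlib

open Pointwise

/-- Edge boundary of a finite set `S ⊆ ℤ^d` in the Cayley graph generated by `u`. -/
def edgeBdry {d k : ℕ} (u : Fin k → (Fin d → ℤ)) (S : Finset (Fin d → ℤ)) : ℕ :=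
  ∑ i, (S.filter (fun v => v + u i ∉ S)).card

/-- `∂*(n)`: the minimum edge boundary over all finite `S ⊆ ℤ^d` with `|S| = n`. -/
noncomputable def edgeOpt {d k : ℕ} (u : Fin k → (Fin d → ℤ)) (n : ℕ) : ℕ :=
  sInf {m | ∃ S : Finset (Fin d → ℤ), S.card = n ∧ edgeBdry u S = m}

/-- The vertices of `S` that leave `S` under translation by `t`. -/
def exitSet {d : ℕ} (t : Fin d → ℤ) (S : Finset (Fin d → ℤ)) : Finset (Fin d → ℤ) :=
  S.filter (fun v => v + t ∉ S)

lemma mem_exitSet {d : ℕ} {t v : Fin d → ℤ} {S : Finset (Fin d → ℤ)} :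
    v ∈ exitSet t S ↔ v ∈ S ∧ v + t ∉ S := by
  simp [exitSet]

lemma edgeBdry_eq_sum_exitSet {d k : ℕ} (u : Fin k → (Fin d → ℤ)) (S : Finset (Fin d → ℤ)) :
    edgeBdry u S = ∑ i, (exitSet (u i) S).card := rfl

lemma card_exitSet_union_add_inter_le {d : ℕ} (t : Fin d → ℤ) (A B : Finset (Fin d → ℤ)) :
    (exitSet t (A ∪ B)).card + (exitSet t (A ∩ B)).card
      ≤ (exitSet t A).card + (exitSet t B).card := by
  rw [← Finset.card_union_add_card_inter (exitSet t (A ∪ B)),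
    ← Finset.card_union_add_card_inter (exitSet t A)]
  apply Nat.add_le_add <;> apply Finset.card_le_card <;> intro v <;>
    simp only [Finset.mem_union, Finset.mem_inter, mem_exitSet] <;> tauto

/-- The edge boundary is submodular. -/
lemma edgeBdry_union_add_inter_le {d k : ℕ} (u : Fin k → (Fin d → ℤ))
    (A B : Finset (Fin d → ℤ)) :
    edgeBdry u (A ∪ B) + edgeBdry u (A ∩ B) ≤ edgeBdry u A + edgeBdry u B := by
  simp only [edgeBdry_eq_sum_exitSet, ← Finset.sum_add_distrib]
  exact Finset.sum_le_sum fun i _ => card_exitSet_union_add_inter_le (u i) A B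

lemma exitSet_image_add_right {d : ℕ} (t s : Fin d → ℤ) (S : Finset (Fin d → ℤ)) :
    exitSet t (S.image (· + s)) = (exitSet t S).image (· + s) := by
  ext v
  simp only [mem_exitSet, Finset.mem_image]
  constructor
  · rintro ⟨⟨w, hw, rfl⟩, h⟩
    exact ⟨w, ⟨hw, fun h' => h ⟨w + t, h', by abel⟩⟩, rfl⟩
  · rintro ⟨w, ⟨hw, h⟩, rfl⟩
    refine ⟨⟨w, hw, rfl⟩, ?_⟩
    rintro ⟨x, hx, hxe⟩
    have : x = w + t := add_right_cancel (b := s) (by rw [hxe]; abel)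
    exact h (this ▸ hx)

lemma edgeBdry_image_add_right {d k : ℕ} (u : Fin k → (Fin d → ℤ)) (s : Fin d → ℤ)
    (S : Finset (Fin d → ℤ)) : edgeBdry u (S.image (· + s)) = edgeBdry u S := by
  simp only [edgeBdry_eq_sum_exitSet, exitSet_image_add_right,
    Finset.card_image_of_injective _ (add_left_injective s)]

lemma card_inter_image_add_right {d : ℕ} (t : Fin d → ℤ) (S : Finset (Fin d → ℤ)) :
    (S ∩ S.image (· + t)).card + (exitSet t S).card = S.card := by
  have h : S.image (· + t) \ S = (exitSet t S).image (· + t) := by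
    ext v
    simp only [mem_exitSet, Finset.mem_image, Finset.mem_sdiff]
    constructor
    · rintro ⟨⟨w, hw, rfl⟩, h⟩
      exact ⟨w, ⟨hw, h⟩, rfl⟩
    · rintro ⟨w, ⟨hw, h⟩, rfl⟩
      exact ⟨⟨w, hw, rfl⟩, h⟩
  rw [← Finset.card_image_of_injective (exitSet t S) (add_left_injective t), ← h,
    Finset.inter_comm, Finset.card_inter_add_card_sdiff,
    Finset.card_image_of_injective _ (add_left_injective t)]

lemma add_zero_pair {d : ℕ} (t : Fin d → ℤ) (S : Finset (Fin d → ℤ)) :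
    S + {0, t} = S ∪ S.image (· + t) := by
  rw [Finset.insert_eq, Finset.add_union, Finset.singleton_zero, add_zero, Finset.add_singleton]
  rfl

lemma edgeOpt_le {d k : ℕ} (u : Fin k → (Fin d → ℤ)) (S : Finset (Fin d → ℤ)) :
    edgeOpt u S.card ≤ edgeBdry u S :=
  Nat.sInf_le ⟨S, rfl, rfl⟩

lemma exists_edgeBdry_eq_edgeOpt {d k : ℕ} (hd : 1 ≤ d) (u : Fin k → (Fin d → ℤ)) (n : ℕ) :
    ∃ S : Finset (Fin d → ℤ), S.card = n ∧ edgeBdry u S = edgeOpt u n := by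
  have : Nonempty (Fin d) := ⟨⟨0, hd⟩⟩
  obtain ⟨S, hS⟩ := Infinite.exists_subset_card_eq (Fin d → ℤ) n
  exact Nat.sInf_mem (s := {m | ∃ S : Finset (Fin d → ℤ), S.card = n ∧ edgeBdry u S = m})
    ⟨_, S, hS, rfl⟩

lemma edgeOpt_add_le {d k : ℕ} (hd : 1 ≤ d) (u : Fin k → (Fin d → ℤ)) (a b : ℕ) :
    edgeOpt u (a + b) ≤ edgeOpt u a + edgeOpt u b := by
  have : Nonempty (Fin d) := ⟨⟨0, hd⟩⟩
  obtain ⟨S, rfl, hS⟩ := exists_edgeBdry_eq_edgeOpt hd u a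
  obtain ⟨T, rfl, hT⟩ := exists_edgeBdry_eq_edgeOpt hd u b
  obtain ⟨t, ht⟩ := Infinite.exists_notMem_finset (S - T)
  have hdisj : Disjoint S (T.image (· + t)) := by
    rw [Finset.disjoint_left]
    intro v hv hv'
    obtain ⟨w, hw, rfl⟩ := Finset.mem_image.1 hv'
    exact ht (Finset.mem_sub.2 ⟨_, hv, w, hw, by abel⟩)
  have hcard : (S ∪ T.image (· + t)).card = S.card + T.card := by
    rw [Finset.card_union_of_disjoint hdisj,
      Finset.card_image_of_injective _ (add_left_injective t)]
  have h1 := edgeBdry_union_add_inter_le u S (T.image (· + t))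
  have h2 := edgeOpt_le u (S ∪ T.image (· + t))
  rw [hcard] at h2
  rw [edgeBdry_image_add_right] at h1
  omega

/-- Erasing a point whose two neighbours in direction `t` are not both present does not increase
the boundary in that direction. -/
lemma card_exitSet_erase_le {d : ℕ} {t v : Fin d → ℤ} {S : Finset (Fin d → ℤ)} (hv : v ∈ S)
    (h : v - t ∉ S ∨ v + t ∉ S) : (exitSet t (S.erase v)).card ≤ (exitSet t S).card := by
  rcases h with h | h
  · apply Finset.card_le_card
    intro w
    simp only [mem_exitSet, Finset.mem_erase]
    rintro ⟨⟨hwv, hw⟩, hwt⟩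
    refine ⟨hw, fun hS => hwt ⟨?_, hS⟩⟩
    rintro rfl
    exact h (by simpa using hw)
  · have hsub : exitSet t (S.erase v) ⊆ insert (v - t) ((exitSet t S).erase v) := by
      intro w
      simp only [mem_exitSet, Finset.mem_erase, Finset.mem_insert]
      rintro ⟨⟨hwv, hw⟩, hwt⟩
      by_cases hwe : w + t = v
      · exact Or.inl (by rw [← hwe]; abel)
      · exact Or.inr ⟨hwv, hw, fun hS => hwt ⟨hwe, hS⟩⟩
    have hmem : v ∈ exitSet t S := mem_exitSet.2 ⟨hv, h⟩
    calc _ ≤ _ := Finset.card_le_card hsub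
      _ ≤ _ := Finset.card_insert_le _ _
      _ = _ := Finset.card_erase_add_one hmem

lemma exists_edgeBdry_erase_le {d k : ℕ} (u : Fin k → (Fin d → ℤ)) (hu : ∀ i, u i ≠ 0)
    {S : Finset (Fin d → ℤ)} (hS : S.Nonempty) :
    ∃ v ∈ S, edgeBdry u (S.erase v) ≤ edgeBdry u S := by
  obtain ⟨v, hv, hmin⟩ := Finset.exists_min_image S toLex hS
  refine ⟨v, hv, Finset.sum_le_sum fun i _ => card_exitSet_erase_le hv ?_⟩
  by_contra! hcon
  have h1 := hmin _ hcon.1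
  have h2 := hmin _ hcon.2
  rw [toLex_sub, le_sub_self_iff] at h1
  rw [toLex_add, le_add_iff_nonneg_right] at h2
  exact hu i (toLex.injective (le_antisymm h1 h2))

lemma edgeOpt_mono {d k : ℕ} (hd : 1 ≤ d) (u : Fin k → (Fin d → ℤ)) (hu : ∀ i, u i ≠ 0) :
    Monotone (edgeOpt u) := by
  refine monotone_nat_of_le_succ fun n => ?_
  obtain ⟨S, hS, hb⟩ := exists_edgeBdry_eq_edgeOpt hd u (n + 1)
  obtain ⟨v, hv, hle⟩ := exists_edgeBdry_erase_le u hu (S := S) (Finset.card_pos.1 (by omega))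
  have h := edgeOpt_le u (S.erase v)
  rw [Finset.card_erase_of_mem hv, hS, Nat.add_sub_cancel] at h
  exact (h.trans hle).trans hb.le

/-- The cube with side length `L + 2 * A` has small boundary in direction `t` when `t` is bounded
by `A`. -/
lemma card_exitSet_cube_le {d : ℕ} (t : Fin d → ℤ) (A L : ℕ) (ht : ∀ j, |t j| ≤ A) :
    (exitSet t (Fintype.piFinset fun _ : Fin d => Finset.Ico (0 : ℤ) (L + 2 * A : ℕ))).card
      + L ^ d ≤ (L + 2 * A) ^ d := by
  set Q := Fintype.piFinset fun _ : Fin d => Finset.Ico (0 : ℤ) (L + 2 * A : ℕ) with hQ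
  set R := Fintype.piFinset fun _ : Fin d => Finset.Ico (A : ℤ) (L + A : ℕ) with hR
  have hRc : R.card = L ^ d := by simp [hR]
  have hQc : Q.card = (L + 2 * A) ^ d := by
    rw [hQ, Fintype.card_piFinset]
    simp only [Int.card_Ico, Finset.prod_const, Finset.card_univ, Fintype.card_fin]
    congr 1
  rw [← hRc, ← hQc, ← Finset.card_union_of_disjoint]
  · apply Finset.card_le_card
    refine Finset.union_subset (Finset.filter_subset _ _) ?_
    refine Fintype.piFinset_subset _ _ fun _ => Finset.Ico_subset_Ico ?_ ?_ <;> push_cast <;> omega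
  · rw [Finset.disjoint_left]
    intro v hv hvR
    refine (mem_exitSet.1 hv).2 (Fintype.mem_piFinset.2 fun j => ?_)
    have h1 := Finset.mem_Ico.1 (Fintype.mem_piFinset.1 hvR j)
    have h2 := abs_le.1 (ht j)
    rw [Finset.mem_Ico, Pi.add_apply]
    push_cast at h1 ⊢
    omega

lemma exists_edgeOpt_le_mul {d k : ℕ} (u : Fin k → (Fin d → ℤ)) {η : ℝ} (hη : 0 < η) :
    ∃ n : ℕ, n ≠ 0 ∧ (edgeOpt u n : ℝ) ≤ η * n := by
  obtain ⟨A, hA⟩ : ∃ A : ℕ, ∀ i j, |u i j| ≤ A := by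
    refine ⟨∑ i, ∑ j, (u i j).natAbs, fun i j => ?_⟩
    rw [Int.abs_eq_natAbs, Int.ofNat_le]
    exact (Finset.single_le_sum (f := fun j => (u i j).natAbs) (fun _ _ => Nat.zero_le _)
      (Finset.mem_univ j)).trans (Finset.single_le_sum (f := fun i => ∑ j, (u i j).natAbs)
      (fun _ _ => Nat.zero_le _) (Finset.mem_univ i))
  obtain ⟨L, hL⟩ := exists_nat_gt (k * (d * (2 * A)) / η : ℝ)
  have hL0 : (0 : ℝ) < L := lt_of_le_of_lt (by positivity) hL
  set N : ℕ := L + 2 * A with hN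
  have hN0 : (0 : ℝ) < N := by rw [hN]; push_cast; positivity
  refine ⟨N ^ d, pow_ne_zero _ (by exact_mod_cast hN0.ne'), ?_⟩
  set Q := Fintype.piFinset fun _ : Fin d => Finset.Ico (0 : ℤ) (N : ℕ) with hQ
  have hQc : Q.card = N ^ d := by simp [hQ]
  have hbern : (N : ℝ) ^ d - (L : ℝ) ^ d ≤ d * (2 * A / N) * (N : ℝ) ^ d := by
    have hLN : (L : ℝ) / N = 1 + -(2 * A / N) := by
      field_simp
      rw [hN]; push_cast; ring
    have h := one_add_mul_le_pow (a := -(2 * A / N : ℝ))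
      (by rw [← sub_nonneg]; have : (0:ℝ) ≤ L / N := by positivity
          linarith) d
    rw [← hLN, div_pow, le_div_iff₀ (by positivity)] at h
    linarith
  have hi : ∀ i, ((exitSet (u i) Q).card : ℝ) ≤ d * (2 * A / N) * (N : ℝ) ^ d := fun i => by
    have h := card_exitSet_cube_le (u i) A L (hA i)
    rw [← hN, ← hQ] at h
    have h' : ((exitSet (u i) Q).card : ℝ) + (L : ℝ) ^ d ≤ (N : ℝ) ^ d := by exact_mod_cast h
    linarith
  have hb : (edgeBdry u Q : ℝ) ≤ k * (d * (2 * A / N) * (N : ℝ) ^ d) := by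
    rw [edgeBdry_eq_sum_exitSet]
    push_cast
    simpa using Finset.sum_le_card_nsmul Finset.univ _ _ fun i _ => hi i
  have hopt : (edgeOpt u (N ^ d) : ℝ) ≤ edgeBdry u Q := by
    rw [← hQc]; exact_mod_cast edgeOpt_le u Q
  have hη' : (k * (d * (2 * A)) : ℝ) / N ≤ η := by
    rw [div_lt_iff₀ hη] at hL
    rw [div_le_iff₀ hN0]
    have : (L : ℝ) ≤ N := by rw [hN]; push_cast; linarith [Nat.cast_nonneg (α := ℝ) A]
    nlinarith
  calc (edgeOpt u (N ^ d) : ℝ) ≤ k * (d * (2 * A / N) * (N : ℝ) ^ d) := hopt.trans hb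
    _ = (k * (d * (2 * A)) : ℝ) / N * (N : ℝ) ^ d := by ring
    _ ≤ η * (N ^ d : ℕ) := by push_cast; gcongr

/-- The optimal edge boundary is sublinear in the size of the set. -/
lemma eventually_edgeOpt_le_mul {d k : ℕ} (hd : 1 ≤ d) (u : Fin k → (Fin d → ℤ)) {η : ℝ}
    (hη : 0 < η) : ∃ n₁ : ℕ, ∀ n, n₁ ≤ n → (edgeOpt u n : ℝ) ≤ η * n := by
  have hsub : Subadditive fun n => (edgeOpt u n : ℝ) := fun a b => by
    have := edgeOpt_add_le hd u a b
    beta_reduce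
    exact_mod_cast this
  have hbdd : BddBelow (Set.range fun n => (edgeOpt u n : ℝ) / n) :=
    ⟨0, by rintro _ ⟨n, rfl⟩; positivity⟩
  have hlim : hsub.lim < η := by
    obtain ⟨n, hn, hle⟩ := exists_edgeOpt_le_mul u (half_pos hη)
    have h := hsub.lim_le_div hbdd hn
    have hn' : (0 : ℝ) < n := by exact_mod_cast Nat.pos_of_ne_zero hn
    have := (div_le_iff₀ hn').2 hle
    linarith
  obtain ⟨n₁, h⟩ := Filter.eventually_atTop.1
    ((hsub.tendsto_lim hbdd).eventually (gt_mem_nhds hlim))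
  refine ⟨n₁ + 1, fun n hn => ?_⟩
  have hn' : (0 : ℝ) < n := by exact_mod_cast (by omega : 0 < n)
  exact (div_le_iff₀ hn').1 (h n (by omega)).le

/-- Submodularity applied to `S` and its translate by `t`, whose intersection has
`S.card - (exitSet t S).card` elements. -/
lemma edgeBdry_add_zero_pair_add_edgeOpt_le {d k : ℕ} (u : Fin k → (Fin d → ℤ)) (t : Fin d → ℤ)
    (S : Finset (Fin d → ℤ)) :
    edgeBdry u (S + {0, t}) + edgeOpt u (S.card - (exitSet t S).card) ≤ 2 * edgeBdry u S := by
  have h1 := edgeBdry_union_add_inter_le u S (S.image (· + t))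
  have h2 := edgeOpt_le u (S ∩ S.image (· + t))
  rw [← card_inter_image_add_right t S, Nat.add_sub_cancel, add_zero_pair]
  rw [edgeBdry_image_add_right] at h1
  omega

theorem pushing_preserves_optimality (d k : ℕ) (hd : 1 ≤ d)
    (u : Fin k → (Fin d → ℤ)) (hu : ∀ i, u i ≠ 0)
    (hgen : AddSubgroup.closure (Set.range u) = ⊤)
    (ε : ℝ) (hε : 0 < ε) :
    ∃ n₀ : ℕ, ∀ S : Finset (Fin d → ℤ), n₀ ≤ S.card →
      (edgeBdry u S : ℝ) ≤ (1 + ε) * (edgeOpt u S.card : ℝ) →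
      ∀ i : Fin k,
        (edgeBdry u (S + ({0, u i} : Finset (Fin d → ℤ))) : ℝ)
          ≤ (1 + 3 * ε) * (edgeOpt u (S + ({0, u i} : Finset (Fin d → ℤ))).card : ℝ) := by
  have hmono := edgeOpt_mono hd u hu
  suffices h : ∃ n₀ : ℕ, ∀ n m : ℕ, n₀ ≤ n → m ≤ n → (m : ℝ) ≤ (1 + ε) * edgeOpt u n →
      (edgeOpt u n : ℝ) ≤ edgeOpt u (n - m) + ε * edgeOpt u n by
    obtain ⟨n₀, h⟩ := h
    refine ⟨n₀, fun S hS hb i => ?_⟩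
    have hm : (exitSet (u i) S).card ≤ edgeBdry u S :=
      Finset.single_le_sum (f := fun i => (exitSet (u i) S).card) (fun _ _ => Nat.zero_le _)
        (Finset.mem_univ i)
    have h1 := h S.card (exitSet (u i) S).card hS (Finset.card_filter_le _ _)
      (le_trans (by exact_mod_cast hm) hb)
    have h2 : (edgeBdry u (S + {0, u i}) : ℝ) + edgeOpt u (S.card - (exitSet (u i) S).card)
        ≤ 2 * edgeBdry u S := by
      exact_mod_cast edgeBdry_add_zero_pair_add_edgeOpt_le u (u i) S
    have h3 : (edgeOpt u S.card : ℝ) ≤ edgeOpt u (S + {0, u i}).card := by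
      refine Nat.cast_le.2 (hmono (Finset.card_le_card ?_))
      rw [add_zero_pair]
      exact Finset.subset_union_left
    calc (edgeBdry u (S + {0, u i}) : ℝ) ≤ (1 + 3 * ε) * edgeOpt u S.card := by linarith
      _ ≤ _ := by gcongr
  by_cases hbdd : ∃ C, ∀ n, edgeOpt u n ≤ C
  · obtain ⟨C, hC⟩ := hbdd
    obtain ⟨b, N, hN⟩ := converges_of_monotone_of_bounded hmono hC
    refine ⟨N + ⌊(1 + ε) * b⌋₊, fun n m hn _ hm => ?_⟩
    rw [hN n (by omega)] at hm ⊢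
    have hmb := Nat.le_floor hm
    rw [hN (n - m) (by omega)]
    exact le_add_of_nonneg_right (by positivity)
  · push Not at hbdd
    obtain ⟨n₁, hn₁⟩ := eventually_edgeOpt_le_mul hd u (η := ε / (1 + ε)) (by positivity)
    obtain ⟨n₀, hn₀⟩ := hbdd n₁
    refine ⟨n₀, fun n m hn hmn hm => ?_⟩
    set M := ⌊(1 + ε) * edgeOpt u n⌋₊ with hM
    have hnM : n₁ ≤ M := by
      refine hn₀.le.trans ((hmono hn).trans (Nat.le_floor ?_))
      nlinarith [Nat.cast_nonneg (α := ℝ) (edgeOpt u n)]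
    have h1 : (edgeOpt u m : ℝ) ≤ edgeOpt u M := Nat.cast_le.2 (hmono (Nat.le_floor hm))
    have h2 : (edgeOpt u M : ℝ) ≤ ε * edgeOpt u n := calc
      (edgeOpt u M : ℝ) ≤ ε / (1 + ε) * M := hn₁ M hnM
      _ ≤ ε / (1 + ε) * ((1 + ε) * edgeOpt u n) := by
        gcongr
        exact Nat.floor_le (by positivity)
      _ = ε * edgeOpt u n := by field_simp
    have h3 : (edgeOpt u n : ℝ) ≤ edgeOpt u (n - m) + edgeOpt u m := by
      have := edgeOpt_add_le hd u (n - m) m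
      rw [Nat.sub_add_cancel hmn] at this
      exact_mod_cast this
    linarith
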